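/- arXiv:1303.1032 — 6 statements merged into one kernel-verified Lean document; each statement's English description precedes it below -/
import Mathlib

section
/- Let A be a noetherian normal local domain containing a field of characteristic 0, let a ∈ A and q ∈ A[y] be such that a and q(y) generate the unit ideal of A[y], and let Q(y) = ∫_0^y q(τ)dτ be the antiderivative of q vanishing at 0. Consider the A-derivation ∂ = a ∂_y + q(y) ∂_z of A[y,z] and set v = a·z − Q(y), so that ∂v = 0. Then the fixed point free G_a-action generated by ∂ is equivariantly trivial: there exists s ∈ A[y,z] with ∂s = 1 such that the A-algebra homomorphism A[V,S] → A[y,z], V ↦ v, S ↦ s, is an isomorphism; in particular ker ∂ = A[v]. -/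
/- STATEMENT 4: A fixed point free triangular G_a-action on A^2 over a
noetherian normal local domain containing a field of characteristic 0 is
equivariantly trivial, with v = a·z − Q(y) and a slice s giving coordinates,
and ker ∂ = A[v]. -/

open MvPolynomial

/-- The kernel of a derivation, as a subalgebra. -/
def kerDer {R B : Type*} [CommRing R] [CommRing B] [Algebra R B]
    (D : Derivation R B B) : Subalgebra R B where
  carrier := {b | D b = 0}
  add_mem' := by
    intro a b ha hb
    simp only [Set.mem_setOf_eq] at ha hb ⊢
    rw [map_add, ha, hb, add_zero]
  mul_mem' := by
    intro a b ha hb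
    simp only [Set.mem_setOf_eq] at ha hb ⊢
    rw [D.leibniz, ha, hb, smul_zero, smul_zero, add_zero]
  algebraMap_mem' := by
    intro r
    show D (algebraMap R B r) = 0
    simp

theorem RingHom.injective_of_surjective_of_isNoetherianRing {R : Type*} [CommRing R]
    [IsNoetherianRing R] (f : R →+* R) (hf : Function.Surjective f) :
    Function.Injective f := by
  have hmono : Monotone fun n : ℕ => RingHom.ker (f ^ n) := by
    refine monotone_nat_of_le_succ fun n x hx => ?_
    rw [RingHom.mem_ker] at hx ⊢
    rw [pow_succ', RingHom.mul_def, RingHom.comp_apply, hx, map_zero]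
  obtain ⟨n, hn⟩ := monotone_stabilizes_iff_noetherian.mpr ‹IsNoetherianRing R› ⟨_, hmono⟩
  have hsurj : Function.Surjective (f ^ n) := by
    rw [RingHom.coe_pow]
    exact hf.iterate n
  refine (injective_iff_map_eq_zero f).mpr fun x hx => ?_
  obtain ⟨w, rfl⟩ := hsurj x
  have hw : w ∈ RingHom.ker (f ^ (n + 1)) := by
    rw [RingHom.mem_ker, pow_succ', RingHom.mul_def, RingHom.comp_apply, hx]
  have h := hn (n + 1) n.le_succ
  change RingHom.ker (f ^ n) = RingHom.ker (f ^ (n + 1)) at h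
  rw [← h] at hw
  exact hw

namespace Polynomial

/-- Over a noetherian `ℚ`-algebra, a polynomial without constant term whose derivative is a unit
has a compositional inverse. -/
theorem exists_comp_eq_X_of_isUnit_derivative {B : Type*} [CommRing B] [IsNoetherianRing B]
    [Algebra ℚ B] (Q : Polynomial B) (hQ0 : Q.coeff 0 = 0) (hQ : IsUnit (derivative Q)) :
    ∃ P : Polynomial B, Q.comp P = X ∧ P.comp Q = X := by
  obtain ⟨h0, hnil⟩ := coeff_isUnit_isNilpotent_of_isUnit hQ
  rw [coeff_derivative] at h0
  obtain ⟨u, hu⟩ : IsUnit (Q.coeff 1) := by simpa using h0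
  have hnilQ : ∀ i, 2 ≤ i → IsNilpotent (Q.coeff i) := by
    intro i hi
    obtain ⟨j, rfl⟩ : ∃ j, i = j + 1 := ⟨i - 1, by omega⟩
    have h := hnil j (by omega)
    rw [coeff_derivative] at h
    have hj : IsUnit ((j : B) + 1) := by
      have : IsUnit ((j : ℚ) + 1) := (by positivity : (j : ℚ) + 1 ≠ 0).isUnit
      simpa using this.map (algebraMap ℚ B)
    obtain ⟨w, hw⟩ := hj.exists_right_inv
    have h2 := (Commute.all (Q.coeff (j + 1) * ((j : B) + 1)) w).isNilpotent_mul_right h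
    rwa [mul_assoc, hw, mul_one] at h2
  have hN : IsNilpotent (Q - C (Q.coeff 1) * X) := by
    rw [Polynomial.isNilpotent_iff]
    intro i
    rcases i with _ | _ | i
    · simp [hQ0]
    · simp
    · simpa [coeff_X] using hnilQ (i + 2) (by omega)
  set x : Polynomial B := C (↑u⁻¹ : B) * X with hx
  set F : Polynomial (Polynomial B) := Q.map C - C X with hF
  have hFe : ∀ p : Polynomial B, aeval p F = Q.comp p - X := by
    intro p
    simp [hF, comp, eval₂_eq_eval_map, coe_aeval_eq_eval]
  have hF' : aeval x (derivative F) = (derivative Q).comp x := by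
    simp [hF, comp, eval₂_eq_eval_map, coe_aeval_eq_eval, derivative_map]
  have h1 : IsNilpotent (aeval x F) := by
    have h := hN.map (compRingHom x)
    rw [hFe]
    rw [coe_compRingHom_apply] at h
    have hux : C (↑u : B) * x = X := by
      rw [hx, ← mul_assoc, ← C_mul, Units.mul_inv, C_1, one_mul]
    rwa [sub_comp, mul_comp, C_comp, X_comp, ← hu, hux] at h
  have h2 : IsUnit (aeval x (derivative F)) := by
    rw [hF']
    exact hQ.map (compRingHom x)
  obtain ⟨P, ⟨-, hP⟩, -⟩ := existsUnique_nilpotent_sub_and_aeval_eq_zero h1 h2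
  rw [hFe, sub_eq_zero] at hP
  refine ⟨P, hP, ?_⟩
  have hsurj : Function.Surjective (compRingHom P) := fun g =>
    ⟨g.comp Q, by rw [coe_compRingHom_apply, comp_assoc, hP, comp_X]⟩
  apply RingHom.injective_of_surjective_of_isNoetherianRing _ hsurj
  simp only [coe_compRingHom_apply, comp_assoc, hP, comp_X, X_comp]

theorem C_dvd_of_map_mk_eq_zero {A : Type*} [CommRing A] (a : A) (p : Polynomial A)
    (h : p.map (Ideal.Quotient.mk (Ideal.span {a})) = 0) : C a ∣ p := by
  rw [C_dvd_iff_dvd_coeff]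
  intro i
  rw [← Ideal.mem_span_singleton, ← Ideal.Quotient.eq_zero_iff_mem, ← coeff_map, h, coeff_zero]

/-- If `a` and the derivative of `Q` generate the unit ideal, then `Q` has a compositional inverse
modulo `a`. -/
theorem exists_comp_sub_X_dvd {A : Type*} [CommRing A] [IsNoetherianRing A] [Algebra ℚ A]
    (a : A) (Q : Polynomial A) (hQ0 : Q.coeff 0 = 0)
    (hQ : Ideal.span ({C a, derivative Q} : Set (Polynomial A)) = ⊤) :
    ∃ P : Polynomial A, C a ∣ Q.comp P - X ∧ C a ∣ P.comp Q - X := by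
  set π := Ideal.Quotient.mk (Ideal.span {a}) with hπ
  have ha : π a = 0 := Ideal.Quotient.eq_zero_iff_mem.mpr (Ideal.mem_span_singleton_self a)
  have hunit : IsUnit (derivative (Q.map π)) := by
    obtain ⟨f, g, hfg⟩ := Ideal.mem_span_pair.mp ((Ideal.eq_top_iff_one _).mp hQ)
    have h := congrArg (map π) hfg
    simp only [Polynomial.map_add, Polynomial.map_mul, map_C, ha, C_0, mul_zero, zero_add,
      Polynomial.map_one] at h
    rw [derivative_map]
    exact .of_mul_eq_one_right _ h
  obtain ⟨P, h1, h2⟩ := exists_comp_eq_X_of_isUnit_derivative (Q.map π)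
    (by rw [coeff_map, hQ0, map_zero]) hunit
  obtain ⟨P, rfl⟩ := map_surjective π Ideal.Quotient.mk_surjective P
  refine ⟨P, C_dvd_of_map_mk_eq_zero _ _ ?_, C_dvd_of_map_mk_eq_zero _ _ ?_⟩
  · rw [Polynomial.map_sub, map_comp, ← hπ, h1, map_X, sub_self]
  · rw [Polynomial.map_sub, map_comp, ← hπ, h2, map_X, sub_self]

theorem sub_dvd_aeval_sub {A B : Type*} [CommRing A] [CommRing B] [Algebra A B] (x y : B)
    (p : Polynomial A) : x - y ∣ aeval x p - aeval y p := by
  simpa only [eval_map_algebraMap] using sub_dvd_eval_sub x y (p.map (algebraMap A B))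

end Polynomial

theorem Derivation.aeval_apply_of_pderiv {A B : Type*} [CommRing A] [CommRing B] [Algebra A B]
    (D : Derivation A B B) (v s : B) (hv : D v = 0) (hs : D s = 1)
    (p : MvPolynomial (Fin 2) A) :
    D (MvPolynomial.aeval (fun i : Fin 2 => if i = 0 then v else s) p) =
      MvPolynomial.aeval (fun i : Fin 2 => if i = 0 then v else s) (pderiv 1 p) := by
  induction p using MvPolynomial.induction_on with
  | C r => simp
  | add p q hp hq => simp only [map_add, hp, hq]
  | mul_X p i hp =>
    rw [map_mul, D.leibniz, hp, pderiv_mul]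
    fin_cases i <;> simp [hv, hs, pderiv_X] <;> ring

theorem MvPolynomial.mem_adjoin_X_zero_of_pderiv_one_eq_zero {A : Type*} [CommRing A]
    [Algebra ℚ A] (p : MvPolynomial (Fin 2) A) (hp : pderiv 1 p = 0) :
    p ∈ Algebra.adjoin A ({X 0} : Set (MvPolynomial (Fin 2) A)) := by
  have h : p ∈ supported A ({0} : Set (Fin 2)) := by
    rw [mem_supported]
    intro i hi
    obtain ⟨m, hm, him⟩ := mem_vars_iff_mem_support i |>.mp hi
    fin_cases i
    · rfl
    · exfalso
      have hm1 : m 1 ≠ 0 := Finsupp.mem_support_iff.mp him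
      have hle : Finsupp.single 1 1 ≤ m :=
        Finsupp.single_le_iff.mpr (Nat.one_le_iff_ne_zero.mpr hm1)
      have h := coeff_pderiv (i := 1) p (m - Finsupp.single 1 1)
      rw [hp, coeff_zero, tsub_add_cancel_of_le hle] at h
      set n : ℕ := (m - Finsupp.single 1 1 : Fin 2 →₀ ℕ) 1
      have hn : IsUnit ((n : A) + 1) := by
        have : IsUnit ((n : ℚ) + 1) := (by positivity : (n : ℚ) + 1 ≠ 0).isUnit
        simpa using this.map (algebraMap ℚ A)
      exact mem_support_iff.mp hm (hn.mul_left_eq_zero.mp h.symm)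
  rwa [supported_eq_adjoin_X, Set.image_singleton] at h

/-- If `D v = 0`, `D s = 1` and `v`, `s` generate the polynomial ring in two variables, then they
are coordinates and the kernel of `D` is generated by `v`. -/
theorem bijective_and_kerDer_eq_adjoin {A : Type*} [CommRing A] [IsNoetherianRing A] [Algebra ℚ A]
    (D : Derivation A (MvPolynomial (Fin 2) A) (MvPolynomial (Fin 2) A))
    (v s : MvPolynomial (Fin 2) A) (hv : D v = 0) (hs : D s = 1)
    (φ : MvPolynomial (Fin 2) A →ₐ[A] MvPolynomial (Fin 2) A)
    (hφ : φ = MvPolynomial.aeval (fun i : Fin 2 => if i = 0 then v else s))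
    (Y Z : MvPolynomial (Fin 2) A) (hY : φ Y = X 0) (hZ : φ Z = X 1) :
    Function.Bijective φ ∧
      kerDer D = Algebra.adjoin A ({v} : Set (MvPolynomial (Fin 2) A)) := by
  have hsurj : Function.Surjective φ := by
    rw [← AlgHom.range_eq_top, ← top_le_iff, ← adjoin_range_X, Algebra.adjoin_le_iff]
    rintro _ ⟨i, rfl⟩
    fin_cases i
    · exact ⟨Y, hY⟩
    · exact ⟨Z, hZ⟩
  have hinj : Function.Injective φ :=
    RingHom.injective_of_surjective_of_isNoetherianRing φ.toRingHom hsurj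
  refine ⟨⟨hinj, hsurj⟩, le_antisymm ?_ ?_⟩
  · intro f hf
    replace hf : D f = 0 := hf
    obtain ⟨p, rfl⟩ := hsurj f
    have hp : pderiv 1 p = 0 := by
      apply hinj
      rw [map_zero, ← hf, hφ]
      exact (D.aeval_apply_of_pderiv v s hv hs p).symm
    have h := Subalgebra.mem_map.mpr
      ⟨p, MvPolynomial.mem_adjoin_X_zero_of_pderiv_one_eq_zero p hp, (rfl : φ p = φ p)⟩
    rw [AlgHom.map_adjoin, Set.image_singleton] at h
    simpa [hφ] using h
  · rw [Algebra.adjoin_le_iff, Set.singleton_subset_iff]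
    exact hv

theorem statement4 {A : Type*} [CommRing A] [IsDomain A] [IsNoetherianRing A]
    [IsLocalRing A] [IsIntegrallyClosed A]
    -- `A` contains a field of characteristic 0
    [Algebra ℚ A]
    (a : A) (q Q : Polynomial A)
    -- a and q(y) generate the unit ideal of A[y]
    (hfree : Ideal.span ({Polynomial.C a, q} : Set (Polynomial A)) = ⊤)
    -- Q(y) = ∫_0^y q(τ)dτ
    (hQd : Polynomial.derivative Q = q) (hQ0 : Q.coeff 0 = 0)
    -- the derivation ∂ = a ∂_y + q(y) ∂_z   (y = X 0, z = X 1)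
    (D : Derivation A (MvPolynomial (Fin 2) A) (MvPolynomial (Fin 2) A))
    (hDy : D (X 0) = C a)
    (hDz : D (X 1) = Polynomial.aeval (X 0 : MvPolynomial (Fin 2) A) q)
    -- v = a·z − Q(y)
    (v : MvPolynomial (Fin 2) A)
    (hv : v = C a * X 1 - Polynomial.aeval (X 0 : MvPolynomial (Fin 2) A) Q) :
    -- ∂v = 0 and the action is equivariantly trivial: A[V,S] ≃ A[y,z], V ↦ v, S ↦ s
    D v = 0 ∧
    ∃ s : MvPolynomial (Fin 2) A, D s = 1 ∧
      Function.Bijective (MvPolynomial.aeval (R := A) (fun i : Fin 2 =>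
        if i = 0 then v else s)) ∧
      kerDer D = Algebra.adjoin A ({v} : Set (MvPolynomial (Fin 2) A)) := by
  have hDp : ∀ p : Polynomial A, D (Polynomial.aeval (X 0 : MvPolynomial (Fin 2) A) p) =
      Polynomial.aeval (X 0 : MvPolynomial (Fin 2) A) (Polynomial.derivative p) * C a := by
    intro p
    rw [Derivation.map_aeval, hDy, smul_eq_mul]
  have hDC : D (C a) = 0 := D.map_algebraMap a
  have hDv : D v = 0 := by
    rw [hv, map_sub, D.leibniz, hDp, hQd, hDz, hDC]
    simp only [smul_eq_mul]
    ring
  refine ⟨hDv, ?_⟩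
  subst hQd
  obtain ⟨P, ⟨G, hG⟩, ⟨H, hH⟩⟩ := Polynomial.exists_comp_sub_X_dvd a Q hQ0 hfree
  have hQP (w : MvPolynomial (Fin 2) A) : Polynomial.aeval (Polynomial.aeval w P) Q =
      w + C a * Polynomial.aeval w G := by
    have h := congrArg (Polynomial.aeval w) hG
    rw [map_sub, Polynomial.aeval_comp, Polynomial.aeval_X, map_mul, Polynomial.aeval_C,
      algebraMap_eq] at h
    linear_combination h
  have hPQ (w : MvPolynomial (Fin 2) A) : Polynomial.aeval (Polynomial.aeval w Q) P =
      w + C a * Polynomial.aeval w H := by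
    have h := congrArg (Polynomial.aeval w) hH
    rw [map_sub, Polynomial.aeval_comp, Polynomial.aeval_X, map_mul, Polynomial.aeval_C,
      algebraMap_eq] at h
    linear_combination h
  by_cases ha : a = 0
  · subst ha
    obtain ⟨f, g, hfg⟩ := Ideal.mem_span_pair.mp ((Ideal.eq_top_iff_one _).mp hfree)
    rw [Polynomial.C_0, mul_zero, zero_add] at hfg
    have hgq (w : MvPolynomial (Fin 2) A) :
        Polynomial.aeval w g * Polynomial.aeval w (Polynomial.derivative Q) = 1 := by
      rw [← map_mul, hfg, map_one]
    have hs : D (Polynomial.aeval (X 0) g * X 1) = 1 := by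
      rw [D.leibniz, hDp, hDz, C_0, mul_zero, smul_zero, add_zero, smul_eq_mul, hgq]
    have hY : Polynomial.aeval (-v) P = X 0 := by
      rw [hv, C_0, zero_mul, zero_sub, neg_neg, hPQ, C_0, zero_mul, add_zero]
    refine ⟨_, hs, bijective_and_kerDer_eq_adjoin D v _ hDv hs _ rfl
      (Polynomial.aeval (-X 0) P)
      (X 1 * Polynomial.aeval (Polynomial.aeval (-X 0) P) (Polynomial.derivative Q)) ?_ ?_⟩
    · rw [← Polynomial.aeval_algHom_apply]
      simpa using hY
    · rw [map_mul, ← Polynomial.aeval_algHom_apply, ← Polynomial.aeval_algHom_apply]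
      simp only [map_neg, aeval_X, if_true, hY, one_ne_zero, if_false]
      linear_combination X 1 * hgq (X 0)
  · have hCa : (C a : MvPolynomial (Fin 2) A) ≠ 0 := by simpa using ha
    obtain ⟨s, hs⟩ : C a ∣ X 0 - Polynomial.aeval (-v) P := by
      have h1 : -v - Polynomial.aeval (X 0) Q ∣ Polynomial.aeval (-v) P -
          Polynomial.aeval (Polynomial.aeval (X 0 : MvPolynomial (Fin 2) A) Q) P :=
        Polynomial.sub_dvd_aeval_sub _ _ _
      obtain ⟨k, hk⟩ := h1
      rw [hPQ, hv] at hk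
      refine ⟨X 1 * k - Polynomial.aeval (X 0) H, ?_⟩
      rw [hv]
      linear_combination -hk
    have hDs : D s = 1 := by
      apply mul_left_cancel₀ hCa
      have h := congrArg D hs
      rw [D.leibniz, map_sub, hDy, Derivation.map_aeval, map_neg, hDv, hDC] at h
      simpa using h.symm
    refine ⟨s, hDs, ?_⟩
    set φ : MvPolynomial (Fin 2) A →ₐ[A] MvPolynomial (Fin 2) A :=
      MvPolynomial.aeval (fun i : Fin 2 => if i = 0 then v else s) with hφ
    have hφ0 : φ (X 0) = v := by simp [hφ]
    have hφ1 : φ (X 1) = s := by simp [hφ]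
    have hφC : φ (C a) = C a := φ.commutes a
    let Y : MvPolynomial (Fin 2) A := C a * X 1 + Polynomial.aeval (-X 0) P
    have hY : φ Y = X 0 := by
      rw [map_add, map_mul, ← Polynomial.aeval_algHom_apply, map_neg, hφ0, hφ1, hφC, ← hs]
      ring
    obtain ⟨k, hk⟩ := Polynomial.sub_dvd_aeval_sub Y (Polynomial.aeval (-X 0) P) Q
    have hZ : C a * (X 1 * k + Polynomial.aeval (-X 0) G) = X 0 + Polynomial.aeval Y Q := by
      rw [hQP, add_sub_cancel_right] at hk
      linear_combination -hk
    refine bijective_and_kerDer_eq_adjoin D v s hDv hDs φ hφ Y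
      (X 1 * k + Polynomial.aeval (-X 0) G) hY ?_
    have h := congrArg φ hZ
    rw [map_mul, map_add φ (X 0), ← Polynomial.aeval_algHom_apply, hY, hφ0, hφC, hv,
      sub_add_cancel] at h
    exact mul_left_cancel₀ hCa h
end

section
/- Let A be a commutative ring containing ℚ, let p, q ∈ A[y], let Q(y) = ∫_0^y q(τ)dτ, and let ℓ ≥ 1. Define E_1(y) = ∫_0^y p(τ)dτ and recursively E_{k+1}(y) = ∫_0^y E_k(τ) q(τ)dτ. Let Γ_ℓ(y₁,y₂) ∈ A[y₁,y₂] be the unique polynomial with ∂Γ_ℓ/∂y₂ = p(y₂)·(Q(y₂)−Q(y₁))^ℓ and Γ_ℓ(y₁,y₁) = 0. Then Γ_ℓ(y₁,y₂) − (−1)^ℓ · ℓ! · ( E_{ℓ+1}(y₂) − E_{ℓ+1}(y₁) ) belongs to the ideal of A[y₁,y₂] generated by Q(y₂)−Q(y₁). -/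
/- STATEMENT 9: Integration by parts: Γ_ℓ(y₁,y₂) ≡ (−1)^ℓ ℓ! (E_{ℓ+1}(y₂) −
E_{ℓ+1}(y₁)) modulo the ideal (Q(y₂)−Q(y₁)). -/

open MvPolynomial

/-- Over a ring containing `ℚ`, a polynomial killed by `∂/∂Xᵢ` does not involve `Xᵢ`. -/
theorem MvPolynomial.notMem_vars_of_pderiv_eq_zero {σ A : Type*} [CommRing A] [Algebra ℚ A]
    {i : σ} {P : MvPolynomial σ A} (h : pderiv i P = 0) : i ∉ P.vars := by
  classical
  intro hi
  obtain ⟨d, hd, hid⟩ := (mem_vars_iff_mem_support i).1 hi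
  have hle : Finsupp.single i 1 ≤ d := by
    rw [Finsupp.single_le_iff]
    exact Nat.one_le_iff_ne_zero.2 (Finsupp.mem_support_iff.1 hid)
  have hc := congrArg (coeff (d - Finsupp.single i 1)) h
  rw [coeff_pderiv, tsub_add_cancel_of_le hle, coeff_zero] at hc
  have hu : IsUnit ((((d - Finsupp.single i 1 : σ →₀ ℕ) i : ℕ) : A) + 1) := by
    have := (IsUnit.mk0 (((d - Finsupp.single i 1 : σ →₀ ℕ) i : ℚ) + 1)
      (by positivity)).map (algebraMap ℚ A)
    rwa [map_add, map_natCast, map_one] at this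
  exact mem_support_iff.1 hd (hu.mul_left_eq_zero.1 hc)

/-- A polynomial in two variables is determined by its derivative in the second variable and its
restriction to the diagonal. -/
theorem MvPolynomial.eq_zero_of_pderiv_one_eq_zero_of_diagonal {A : Type*} [CommRing A]
    [Algebra ℚ A] {P : MvPolynomial (Fin 2) A} (hd : pderiv 1 P = 0)
    (h0 : aeval (fun _ : Fin 2 => (X 0 : MvPolynomial (Fin 2) A)) P = 0) : P = 0 := by
  rw [← h0]
  conv_lhs => rw [← aeval_X_left_apply P]
  refine eval₂Hom_congr' rfl (fun i hi _ => ?_) rfl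
  fin_cases i
  · rfl
  · exact absurd hi (notMem_vars_of_pderiv_eq_zero hd)

/-- Iterated integration by parts: if `F (k + 1)` is an antiderivative of `F k * Q'` for all `k`,
then `(F 0)'(Xᵢ) * D ^ n`, where `∂D/∂Xᵢ = Q'(Xᵢ)`, has an antiderivative congruent to
`(-1) ^ n * n! * F n (Xᵢ)` modulo `D`. -/
theorem MvPolynomial.exists_pderiv_eq_aeval_mul_pow {σ A : Type*} [CommRing A] {i : σ}
    {q : Polynomial A} {D : MvPolynomial σ A}
    (hD : pderiv i D = Polynomial.aeval (X i : MvPolynomial σ A) q) (n : ℕ)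
    (F : ℕ → Polynomial A) (hF : ∀ k, Polynomial.derivative (F (k + 1)) = F k * q) :
    ∃ H : MvPolynomial σ A,
      pderiv i (D * H + (-1) ^ n * (n.factorial : MvPolynomial σ A) *
        Polynomial.aeval (X i : MvPolynomial σ A) (F n)) =
      Polynomial.aeval (X i : MvPolynomial σ A) (Polynomial.derivative (F 0)) * D ^ n := by
  induction n generalizing F with
  | zero => exact ⟨0, by simp [Derivation.map_aeval]⟩
  | succ n ih =>
    obtain ⟨H, hH⟩ := ih (fun k => F (k + 1)) fun k => hF (k + 1)
    simp only [zero_add, hF 0, map_mul] at hH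
    refine ⟨D ^ n * Polynomial.aeval (X i : MvPolynomial σ A) (F 0) -
      ((n + 1 : ℕ) : MvPolynomial σ A) * H, ?_⟩
    have hsplit : D * (D ^ n * Polynomial.aeval (X i : MvPolynomial σ A) (F 0) -
          ((n + 1 : ℕ) : MvPolynomial σ A) * H) +
        (-1) ^ (n + 1) * ((n + 1).factorial : MvPolynomial σ A) *
          Polynomial.aeval (X i : MvPolynomial σ A) (F (n + 1)) =
        D ^ (n + 1) * Polynomial.aeval (X i : MvPolynomial σ A) (F 0) -
        ((n + 1 : ℕ) : MvPolynomial σ A) * (D * H + (-1) ^ n * (n.factorial : MvPolynomial σ A) *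
          Polynomial.aeval (X i : MvPolynomial σ A) (F (n + 1))) := by
      rw [Nat.factorial_succ]
      push_cast
      ring
    rw [hsplit, map_sub, Derivation.leibniz, Derivation.leibniz _ ((n + 1 : ℕ) : MvPolynomial σ A),
      hH, Derivation.leibniz_pow, hD, Derivation.map_aeval, Derivation.map_natCast, pderiv_X_self]
    simp only [smul_eq_mul, nsmul_eq_mul, Nat.add_sub_cancel]
    ring

theorem statement9 {A : Type*} [CommRing A]
    -- `A` contains ℚ
    [Algebra ℚ A]
    (p q Q : Polynomial A)
    -- Q(y) = ∫_0^y q(τ)dτ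
    (hQd : Polynomial.derivative Q = q) (hQ0 : Q.coeff 0 = 0)
    (ℓ : ℕ) (hl : 1 ≤ ℓ)
    -- E_1(y) = ∫_0^y p(τ)dτ and E_{k+1}(y) = ∫_0^y E_k(τ)q(τ)dτ for k ≥ 1
    (E : ℕ → Polynomial A)
    (hE1d : Polynomial.derivative (E 1) = p) (hE10 : (E 1).coeff 0 = 0)
    (hEd : ∀ k, 1 ≤ k → Polynomial.derivative (E (k + 1)) = E k * q)
    (hE0 : ∀ k, 1 ≤ k → (E (k + 1)).coeff 0 = 0)
    -- Γ_ℓ ∈ A[y₁,y₂]: ∂Γ_ℓ/∂y₂ = p(y₂)·(Q(y₂)−Q(y₁))^ℓ and Γ_ℓ(y₁,y₁) = 0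
    -- (y₁ = X 0, y₂ = X 1)
    (Γ : MvPolynomial (Fin 2) A)
    (hΓd : MvPolynomial.pderiv 1 Γ =
      Polynomial.aeval (X 1 : MvPolynomial (Fin 2) A) p *
        (Polynomial.aeval (X 1 : MvPolynomial (Fin 2) A) Q -
          Polynomial.aeval (X 0 : MvPolynomial (Fin 2) A) Q) ^ ℓ)
    (hΓ0 : MvPolynomial.aeval (fun _ : Fin 2 => (X 0 : MvPolynomial (Fin 2) A)) Γ = 0) :
    Γ - ((-1 : ℚ) ^ ℓ * (ℓ.factorial : ℚ)) •
        (Polynomial.aeval (X 1 : MvPolynomial (Fin 2) A) (E (ℓ + 1)) -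
          Polynomial.aeval (X 0 : MvPolynomial (Fin 2) A) (E (ℓ + 1))) ∈
      Ideal.span ({Polynomial.aeval (X 1 : MvPolynomial (Fin 2) A) Q -
          Polynomial.aeval (X 0 : MvPolynomial (Fin 2) A) Q} :
        Set (MvPolynomial (Fin 2) A)) := by
  set y₁ : MvPolynomial (Fin 2) A := X 0
  set y₂ : MvPolynomial (Fin 2) A := X 1
  set D := Polynomial.aeval y₂ Q - Polynomial.aeval y₁ Q with hDdef
  have h₁ (f : Polynomial A) : pderiv 1 (Polynomial.aeval y₁ f) = 0 := by
    rw [Derivation.map_aeval, pderiv_X_of_ne (by decide), smul_zero]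
  have hD : pderiv 1 D = Polynomial.aeval y₂ q := by
    rw [hDdef, map_sub, h₁, sub_zero, Derivation.map_aeval, pderiv_X_self, hQd, smul_eq_mul,
      mul_one]
  obtain ⟨H, hH⟩ := exists_pderiv_eq_aeval_mul_pow hD ℓ (fun k => E (k + 1))
    fun k => hEd (k + 1) (Nat.le_add_left 1 k)
  simp only [zero_add, hE1d] at hH
  have hdiag (f : Polynomial A) (i : Fin 2) :
      aeval (fun _ : Fin 2 => y₁) (Polynomial.aeval (X i : MvPolynomial (Fin 2) A) f) =
        Polynomial.aeval y₁ f := by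
    rw [← Polynomial.aeval_algHom_apply, aeval_X]
  have hΓ : Γ - (D * H + (-1) ^ ℓ * (ℓ.factorial : MvPolynomial (Fin 2) A) *
        Polynomial.aeval y₂ (E (ℓ + 1)) - (-1) ^ ℓ * (ℓ.factorial : MvPolynomial (Fin 2) A) *
        Polynomial.aeval y₁ (E (ℓ + 1))) = 0 := by
    refine eq_zero_of_pderiv_one_eq_zero_of_diagonal ?_ ?_
    · have hc : pderiv 1 ((-1) ^ ℓ * (ℓ.factorial : MvPolynomial (Fin 2) A) *
          Polynomial.aeval y₁ (E (ℓ + 1))) = 0 := by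
        have := h₁ (Polynomial.C ((-1) ^ ℓ * (ℓ.factorial : A)) * E (ℓ + 1))
        simpa using this
      rw [map_sub, map_sub, hc, hH, hΓd, sub_zero, sub_self]
    · simp only [map_sub, map_add, map_mul, map_pow, map_neg, map_one, map_natCast, hDdef,
        y₁, y₂, hdiag, hΓ0]
      ring
  rw [Ideal.mem_span_singleton]
  refine ⟨H, ?_⟩
  rw [Algebra.smul_def, map_mul, map_pow, map_neg, map_one, map_natCast]
  linear_combination hΓ
end

section
/- Let κ be an algebraically closed field of characteristic 0, let q ∈ κ[y] be a non-constant polynomial, let p ∈ κ[y] be a nonzero polynomial, let ℓ ≥ 1, and let Q(y) = ∫_0^y q(τ)dτ. Let Γ_ℓ(y₁,y₂) ∈ κ[y₁,y₂] be the unique polynomial with ∂Γ_ℓ/∂y₂ = p(y₂)·(Q(y₂)−Q(y₁))^ℓ and Γ_ℓ(y₁,y₁) = 0. Then (y₂−y₁)^{ℓ+1} divides Γ_ℓ and (y₂−y₁) divides Q(y₂)−Q(y₁) in κ[y₁,y₂], and the polynomials Θ = Γ_ℓ/(y₂−y₁)^{ℓ+1} and R = (Q(y₂)−Q(y₁))/(y₂−y₁)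 have a common zero: there exists (a,b) ∈ κ² with Θ(a,b) = 0 and R(a,b) = 0. -/
/- STATEMENT 12: Over an algebraically closed field κ of characteristic 0, the
curves Θ = Γ_ℓ/(y₂−y₁)^{ℓ+1} = 0 and R = (Q(y₂)−Q(y₁))/(y₂−y₁) = 0 always
intersect. -/

open MvPolynomial

/-- A bivariate polynomial is congruent to its restriction to the diagonal modulo `y₂ - y₁`. -/
lemma X_sub_X_dvd_sub_diagonal {R : Type*} [CommRing R] (f : MvPolynomial (Fin 2) R) :
    (X 1 - X 0 : MvPolynomial (Fin 2) R) ∣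
      f - aeval (fun _ : Fin 2 => (X 0 : MvPolynomial (Fin 2) R)) f := by
  induction f using MvPolynomial.induction_on with
  | C a => simp [← MvPolynomial.algebraMap_eq]
  | add f g hf hg =>
    rw [map_add, add_sub_add_comm]
    exact dvd_add hf hg
  | mul_X f i hf =>
    obtain ⟨u, hu⟩ := hf
    rw [map_mul, aeval_X]
    fin_cases i
    · exact ⟨u * X 0, by simp only [Fin.zero_eta]; linear_combination X 0 * hu⟩
    · exact ⟨u * X 0 + f, by simp only [Fin.mk_one]; linear_combination X 0 * hu⟩

lemma X_sub_X_dvd_of_diagonal_eq_zero {R : Type*} [CommRing R] {f : MvPolynomial (Fin 2) R}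
    (hf : aeval (fun _ : Fin 2 => (X 0 : MvPolynomial (Fin 2) R)) f = 0) :
    (X 1 - X 0 : MvPolynomial (Fin 2) R) ∣ f := by
  have h := X_sub_X_dvd_sub_diagonal f
  rwa [hf, sub_zero] at h

lemma X_one_sub_X_zero_ne_zero {κ : Type*} [Field κ] :
    (X 1 - X 0 : MvPolynomial (Fin 2) κ) ≠ 0 :=
  sub_ne_zero.2 fun h => by simpa using X_injective h

lemma pderiv_X_sub_X_pow_mul {R : Type*} [CommRing R] (k : ℕ) (h : MvPolynomial (Fin 2) R) :
    pderiv 1 ((X 1 - X 0) ^ (k + 1) * h) =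
      (X 1 - X 0) ^ k * (((k : MvPolynomial (Fin 2) R) + 1) * h + (X 1 - X 0) * pderiv 1 h) := by
  have h0 : pderiv (R := R) (1 : Fin 2) (X 0) = 0 := pderiv_X_of_ne (by decide)
  rw [Derivation.leibniz, Derivation.leibniz_pow, map_sub, pderiv_X_self, h0]
  simp only [smul_eq_mul, nsmul_eq_mul, Nat.add_sub_cancel, Nat.cast_add, Nat.cast_one]
  ring

/-- If `∂f/∂y₂` is divisible by `(y₂ - y₁)ⁿ` and `f` vanishes on the diagonal, then `f` is
divisible by `(y₂ - y₁)ⁿ⁺¹`, and the cofactors are related by a differential equation. -/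
lemma exists_eq_X_sub_X_pow_mul {κ : Type*} [Field κ] [CharZero κ] (n : ℕ)
    {f g : MvPolynomial (Fin 2) κ} (hd : pderiv 1 f = (X 1 - X 0) ^ n * g)
    (h0 : aeval (fun _ : Fin 2 => (X 0 : MvPolynomial (Fin 2) κ)) f = 0) :
    ∃ h : MvPolynomial (Fin 2) κ, f = (X 1 - X 0) ^ (n + 1) * h ∧
      ((n : MvPolynomial (Fin 2) κ) + 1) * h + (X 1 - X 0) * pderiv 1 h = g := by
  have key : ∀ k ≤ n, (X 1 - X 0 : MvPolynomial (Fin 2) κ) ^ (k + 1) ∣ f := by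
    intro k
    induction k with
    | zero => exact fun _ => by simpa using X_sub_X_dvd_of_diagonal_eq_zero h0
    | succ k ih =>
      intro hk
      obtain ⟨h, rfl⟩ := ih (by omega)
      obtain ⟨m, rfl⟩ := Nat.exists_eq_add_of_le hk
      rw [pderiv_X_sub_X_pow_mul, add_assoc, pow_add, mul_assoc] at hd
      replace hd := mul_left_cancel₀ (pow_ne_zero _ X_one_sub_X_zero_ne_zero) hd
      rw [pow_succ _ (k + 1)]
      refine mul_dvd_mul_left _ (X_sub_X_dvd_of_diagonal_eq_zero ?_)
      replace hd := congrArg (aeval fun _ : Fin 2 => (X 0 : MvPolynomial (Fin 2) κ)) hd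
      simp only [map_add, map_mul, map_natCast, map_one, map_sub, map_pow, aeval_X, sub_self,
        zero_mul, add_zero, pow_add, pow_one] at hd
      exact (mul_eq_zero.1 hd).resolve_left (Nat.cast_add_one_ne_zero k)
  obtain ⟨h, rfl⟩ := key n le_rfl
  refine ⟨h, rfl, ?_⟩
  rw [pderiv_X_sub_X_pow_mul] at hd
  exact mul_left_cancel₀ (pow_ne_zero _ X_one_sub_X_zero_ne_zero) hd

lemma pderiv_aeval_sub_aeval {R : Type*} [CommRing R] (P : Polynomial R) :
    pderiv 1 (Polynomial.aeval (X 1 : MvPolynomial (Fin 2) R) P -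
      Polynomial.aeval (X 0 : MvPolynomial (Fin 2) R) P) =
      Polynomial.aeval (X 1 : MvPolynomial (Fin 2) R) (Polynomial.derivative P) := by
  have h0 : pderiv (R := R) (1 : Fin 2) (X 0) = 0 := pderiv_X_of_ne (by decide)
  rw [map_sub, Derivation.map_aeval, Derivation.map_aeval, pderiv_X_self, h0]
  simp

theorem statement12 {κ : Type*} [Field κ] [IsAlgClosed κ] [CharZero κ]
    -- q non-constant, p ≠ 0
    (q : Polynomial κ) (hq : 0 < q.natDegree)
    (p : Polynomial κ) (hp : p ≠ 0)
    (ℓ : ℕ) (hl : 1 ≤ ℓ)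
    -- Q(y) = ∫_0^y q(τ)dτ
    (Q : Polynomial κ)
    (hQd : Polynomial.derivative Q = q) (hQ0 : Q.coeff 0 = 0)
    -- Γ_ℓ ∈ κ[y₁,y₂]: ∂Γ_ℓ/∂y₂ = p(y₂)·(Q(y₂)−Q(y₁))^ℓ and Γ_ℓ(y₁,y₁) = 0
    -- (y₁ = X 0, y₂ = X 1)
    (Γ : MvPolynomial (Fin 2) κ)
    (hΓd : MvPolynomial.pderiv 1 Γ =
      Polynomial.aeval (X 1 : MvPolynomial (Fin 2) κ) p *
        (Polynomial.aeval (X 1 : MvPolynomial (Fin 2) κ) Q -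
          Polynomial.aeval (X 0 : MvPolynomial (Fin 2) κ) Q) ^ ℓ)
    (hΓ0 : MvPolynomial.aeval (fun _ : Fin 2 => (X 0 : MvPolynomial (Fin 2) κ)) Γ = 0) :
    -- (y₂−y₁)^{ℓ+1} ∣ Γ_ℓ and (y₂−y₁) ∣ Q(y₂)−Q(y₁), and the quotients Θ and R
    -- have a common zero
    ∃ Θ R : MvPolynomial (Fin 2) κ,
      Γ = (X 1 - X 0) ^ (ℓ + 1) * Θ ∧
      Polynomial.aeval (X 1 : MvPolynomial (Fin 2) κ) Q -
          Polynomial.aeval (X 0 : MvPolynomial (Fin 2) κ) Q = (X 1 - X 0) * R ∧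
      ∃ a b : κ,
        MvPolynomial.eval (fun i : Fin 2 => if i = 0 then a else b) Θ = 0 ∧
        MvPolynomial.eval (fun i : Fin 2 => if i = 0 then a else b) R = 0 := by
  set D : MvPolynomial (Fin 2) κ := X 1 - X 0 with hD
  have hdiag : aeval (fun _ : Fin 2 => (X 0 : MvPolynomial (Fin 2) κ))
      (Polynomial.aeval (X 1 : MvPolynomial (Fin 2) κ) Q -
        Polynomial.aeval (X 0 : MvPolynomial (Fin 2) κ) Q) = 0 := by
    rw [map_sub, ← Polynomial.aeval_algHom_apply, ← Polynomial.aeval_algHom_apply, aeval_X,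
      aeval_X, sub_self]
  obtain ⟨R, hR, hRq⟩ := exists_eq_X_sub_X_pow_mul 0
    (by rw [pderiv_aeval_sub_aeval, hQd, pow_zero, one_mul]) hdiag
  rw [zero_add, pow_one, ← hD] at hR
  rw [hR, mul_pow, mul_left_comm] at hΓd
  obtain ⟨Θ, hΘ, hΘR⟩ := exists_eq_X_sub_X_pow_mul ℓ hΓd hΓ0
  obtain ⟨a, ha⟩ := IsAlgClosed.exists_root q (Polynomial.degree_ne_of_natDegree_ne hq.ne')
  have hva : (fun i : Fin 2 => if i = 0 then a else a) = fun _ => a := by simp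
  have hqa : aeval (fun _ : Fin 2 => a)
      (Polynomial.aeval (X 1 : MvPolynomial (Fin 2) κ) q) = 0 := by
    rw [← Polynomial.aeval_algHom_apply, aeval_X, Polynomial.coe_aeval_eq_eval]
    exact ha
  have hRa : aeval (fun _ : Fin 2 => a) R = 0 := by
    rw [← hRq] at hqa
    simpa using hqa
  have hΘa : aeval (fun _ : Fin 2 => a) Θ = 0 := by
    replace hΘR := congrArg (aeval fun _ : Fin 2 => a) hΘR
    simp only [map_add, map_mul, map_natCast, map_one, map_sub, map_pow, aeval_X, sub_self,
      zero_mul, add_zero, hRa, zero_pow (Nat.one_le_iff_ne_zero.1 hl), mul_zero] at hΘR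
    exact (mul_eq_zero.1 hΘR).resolve_left (Nat.cast_add_one_ne_zero ℓ)
  refine ⟨Θ, R, hΘ, hR, a, a, ?_, ?_⟩
  · rwa [hva, ← coe_aeval_eq_eval]
  · rwa [hva, ← coe_aeval_eq_eval]
end

section
/- Let R be a commutative ring, x ∈ R, and n ≥ 1, r ≥ 1 integers. Let F ∈ R[y] be a polynomial of degree r whose reduction modulo x factors in (R/xR)[y] as ∏_{i=1}^{r} (y − t_i), where t_1, …, t_r ∈ R/xR are such that t_i − t_j is invertible in R/xR for all i ≠ j. Then there exist elements σ_1, …, σ_r ∈ R with σ_i ≡ t_i (mod xR) for each i, and polynomials S_1, S_2 ∈ R[y] with the reduction of S_1 modulo x a unit of (R/xR)[y], such that F(y) = S_1(y) · ∏_{i=1}^{r} (y − σ_i) + x^n · S_2(y). -/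
/-- An element is a unit modulo `x` iff it is coprime to `x`. -/
theorem isUnit_mk_span_singleton_iff_isCoprime {R : Type*} [CommRing R] {x a : R} :
    IsUnit (Ideal.Quotient.mk (Ideal.span ({x} : Set R)) a) ↔ IsCoprime a x := by
  rw [isUnit_iff_exists_inv]
  constructor
  · rintro ⟨b, hb⟩
    obtain ⟨b, rfl⟩ := Ideal.Quotient.mk_surjective b
    rw [← map_mul, ← map_one (Ideal.Quotient.mk _), Ideal.Quotient.mk_eq_mk_iff_sub_mem,
      Ideal.mem_span_singleton] at hb
    obtain ⟨c, hc⟩ := hb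
    exact ⟨b, -c, by linear_combination hc⟩
  · rintro ⟨b, c, h⟩
    refine ⟨Ideal.Quotient.mk _ b, ?_⟩
    rw [← map_mul, ← map_one (Ideal.Quotient.mk _), Ideal.Quotient.mk_eq_mk_iff_sub_mem,
      Ideal.mem_span_singleton]
    exact ⟨-c, by linear_combination h⟩

/-- Newton iteration: a simple root modulo `x` lifts to a root modulo every power of `x`. -/
theorem Polynomial.exists_pow_dvd_eval_of_isCoprime {R : Type*} [CommRing R] {x : R}
    {F : Polynomial R} {s : R} (hs : x ∣ F.eval s) (hd : IsCoprime (F.derivative.eval s) x)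
    (n : ℕ) : ∃ s', x ∣ s' - s ∧ x ^ (n + 1) ∣ F.eval s' := by
  induction n with
  | zero => exact ⟨s, by simp, by simpa using hs⟩
  | succ n ih =>
    obtain ⟨s', hs', hF⟩ := ih
    obtain ⟨u, v, huv⟩ := hd
    obtain ⟨w, hw⟩ := hs'.trans (F.derivative.sub_dvd_eval_sub s' s)
    obtain ⟨c, hc⟩ := hF
    obtain ⟨k, hk⟩ := F.binomExpansion s' (-(F.eval s' * u))
    refine ⟨s' + -(F.eval s' * u), ?_, ?_⟩
    · obtain ⟨d, hd⟩ := hs'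
      exact ⟨d - x ^ n * c * u, by rw [hc]; linear_combination hd⟩
    · rw [hk, hc]
      exact ⟨c * (v - w * u) + k * x ^ n * c ^ 2 * u ^ 2, by
        linear_combination -x ^ (n + 1) * c * huv - x ^ (n + 1) * c * u * hw⟩

open Polynomial in
/-- A polynomial is divisible by the product of the linear factors at roots whose pairwise
differences are units. -/
theorem Polynomial.prod_X_sub_C_dvd_of_isUnit_sub {A ι : Type*} [CommRing A] [Fintype ι]
    {F : A[X]} {a : ι → A} (ha : ∀ i j, i ≠ j → IsUnit (a i - a j))
    (hF : ∀ i, F.eval (a i) = 0) : ∏ i, (X - C (a i)) ∣ F :=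
  Finset.prod_dvd_of_coprime
    (fun i _ j _ hij => isCoprime_X_sub_C_of_isUnit_sub (ha i j hij))
    fun i _ => dvd_iff_isRoot.mpr (hF i)

open Polynomial in
/-- A product of linear factors with unit root differences has unit derivative at its roots. -/
theorem Polynomial.isUnit_eval_derivative_prod_X_sub_C {A ι : Type*} [CommRing A] [Fintype ι]
    {a : ι → A} (ha : ∀ i j, i ≠ j → IsUnit (a i - a j)) (i : ι) :
    IsUnit ((∏ j, (X - C (a j))).derivative.eval (a i)) := by
  classical
  rw [← Finset.mul_prod_erase _ _ (Finset.mem_univ i)]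
  simp only [derivative_mul, derivative_X_sub_C, one_mul, eval_add, eval_mul, eval_sub, eval_X,
    eval_C, sub_self, zero_mul, add_zero, eval_prod]
  rw [IsUnit.prod_iff]
  exact fun j hj => ha i j (Finset.ne_of_mem_erase hj).symm

open Polynomial in
/-- Polynomials agreeing modulo `x` differ by a multiple of `x`. -/
theorem Polynomial.C_dvd_sub_of_map_mk_eq {R : Type*} [CommRing R] {x : R} {F G : R[X]}
    (h : F.map (Ideal.Quotient.mk (Ideal.span ({x} : Set R))) =
      G.map (Ideal.Quotient.mk (Ideal.span ({x} : Set R)))) : C x ∣ F - G := by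
  refine C_dvd_iff_dvd_coeff _ _ |>.mpr fun k => ?_
  have hk := congrArg (fun p => p.coeff k) h
  simp only [coeff_map] at hk
  rwa [Ideal.Quotient.mk_eq_mk_iff_sub_mem, Ideal.mem_span_singleton, ← coeff_sub] at hk


/- STATEMENT 14: Lifting a factorization with pairwise "separated" roots modulo
x to a factorization modulo x^n. -/

theorem statement14 {R : Type*} [CommRing R]
    (x : R) (n r : ℕ) (hn : 1 ≤ n) (hr : 1 ≤ r)
    -- F of degree r
    (F : Polynomial R) (hdeg : F.natDegree = r)
    -- the reduction of F modulo x factors as ∏ (y − t_i)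
    (t : Fin r → R ⧸ Ideal.span ({x} : Set R))
    (hfact : F.map (Ideal.Quotient.mk (Ideal.span ({x} : Set R))) =
      ∏ i, (Polynomial.X - Polynomial.C (t i)))
    -- t_i − t_j is invertible for i ≠ j
    (hsep : ∀ i j, i ≠ j → IsUnit (t i - t j)) :
    ∃ (σ : Fin r → R) (S₁ S₂ : Polynomial R),
      (∀ i, Ideal.Quotient.mk (Ideal.span ({x} : Set R)) (σ i) = t i) ∧
      IsUnit (S₁.map (Ideal.Quotient.mk (Ideal.span ({x} : Set R)))) ∧
      F = S₁ * ∏ i, (Polynomial.X - Polynomial.C (σ i)) + Polynomial.C (x ^ n) * S₂ := by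
  set q := Ideal.Quotient.mk (Ideal.span ({x} : Set R)) with hq
  set p := Ideal.Quotient.mk (Ideal.span ({x ^ n} : Set R)) with hp
  have lift_root (i : Fin r) : ∃ s, q s = t i ∧ x ^ n ∣ F.eval s := by
    obtain ⟨s, hs⟩ := Ideal.Quotient.mk_surjective (t i)
    have hroot : x ∣ F.eval s := by
      rw [← Ideal.mem_span_singleton, ← Ideal.Quotient.eq_zero_iff_mem, ← hq,
        ← Polynomial.eval_map_apply, hfact, hs, Polynomial.eval_prod]
      exact Finset.prod_eq_zero (Finset.mem_univ i) (by simp)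
    have hder : IsCoprime (F.derivative.eval s) x := by
      rw [← isUnit_mk_span_singleton_iff_isCoprime, ← hq, ← Polynomial.eval_map_apply,
        ← Polynomial.derivative_map, hfact, hs]
      exact Polynomial.isUnit_eval_derivative_prod_X_sub_C hsep i
    obtain ⟨s', hs', hF⟩ := Polynomial.exists_pow_dvd_eval_of_isCoprime hroot hder (n - 1)
    rw [Nat.sub_add_cancel hn] at hF
    refine ⟨s', ?_, hF⟩
    rwa [← hs, hq, Ideal.Quotient.mk_eq_mk_iff_sub_mem, Ideal.mem_span_singleton]
  choose σ hσ hF using lift_root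
  have hdvd : ∏ i, (Polynomial.X - Polynomial.C (p (σ i))) ∣ F.map p := by
    refine Polynomial.prod_X_sub_C_dvd_of_isUnit_sub (fun i j hij => ?_) fun i => ?_
    · rw [← map_sub, hp, isUnit_mk_span_singleton_iff_isCoprime]
      refine IsCoprime.pow_right (isUnit_mk_span_singleton_iff_isCoprime.mp ?_)
      rw [map_sub, ← hq, hσ, hσ]
      exact hsep i j hij
    · rw [Polynomial.eval_map_apply, hp, Ideal.Quotient.eq_zero_iff_mem,
        Ideal.mem_span_singleton]
      exact hF i
  obtain ⟨S, hS⟩ := hdvd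
  obtain ⟨S₁, rfl⟩ := Polynomial.map_surjective p Ideal.Quotient.mk_surjective S
  obtain ⟨S₂, hS₂⟩ := Polynomial.C_dvd_sub_of_map_mk_eq (x := x ^ n)
    (F := F) (G := S₁ * ∏ i, (Polynomial.X - Polynomial.C (σ i))) (by
      rw [← hp, hS, mul_comm]
      simp [Polynomial.map_prod])
  have hdecomp := sub_eq_iff_eq_add'.mp hS₂
  refine ⟨σ, S₁, S₂, hσ, ?_, hdecomp⟩
  have hx : q (x ^ n) = 0 := by
    rw [hq, Ideal.Quotient.eq_zero_iff_mem, Ideal.mem_span_singleton]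
    exact dvd_pow_self x (by lia)
  have hmonic : (∏ i, (Polynomial.X - Polynomial.C (t i))).Monic :=
    Polynomial.monic_prod_of_monic _ _ fun i _ => Polynomial.monic_X_sub_C (t i)
  have hred := congrArg (Polynomial.map q) hdecomp
  simp only [Polynomial.map_add, Polynomial.map_mul, Polynomial.map_C, hx, map_zero, zero_mul,
    add_zero, Polynomial.map_prod, Polynomial.map_sub, Polynomial.map_X, hσ, hfact] at hred
  have hone : S₁.map q = 1 := hmonic.isRegular.right (by simpa using hred.symm)
  rw [hone]
  exact isUnit_one
end

section
/- Let κ be a field of characteristic 0 and let C₀ be an integral domain which is a finitely generated κ-algebra of Krull dimension 1. Then every open immersion of schemes from Spec κ[u,v] (the affine plane A²_κ) to Spec C₀[T] (the product C ×_κ A¹_κ, where C = Spec C₀) is an isomorphism. -/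
/- STATEMENT 15: Every open immersion from A²_κ into C ×_κ A¹_κ, with C an
integral affine curve over a field κ of characteristic 0, is an isomorphism. -/

open AlgebraicGeometry CategoryTheory

theorem exists_dvd_algebraMap_and_dvd_pow {B E : Type*} [CommRing B] [IsDomain B]
    [IsIntegrallyClosed B] [CommRing E] [IsDomain E] [IsIntegrallyClosed E] [Algebra B E]
    [Module.Finite B E] [Module.IsTorsionFree B E] {g : E} (hg : g ≠ 0) :
    ∃ h : B, h ≠ 0 ∧ g ∣ algebraMap B E h ∧
      ∀ c : B, g ∣ algebraMap B E c → ∃ n : ℕ, h ∣ c ^ n := by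
  let : Algebra (FractionRing B) (FractionRing E) := FractionRing.liftAlgebra _ _
  have : IsScalarTower B (FractionRing B) (FractionRing E) :=
    FractionRing.isScalarTower_liftAlgebra _ _
  have : IsIntegralClosure E B (FractionRing E) :=
    IsIntegralClosure.of_isIntegrallyClosed _ _ _
  have : Algebra.IsAlgebraic (FractionRing B) (FractionRing E) :=
    isAlgebraic_of_isFractionRing B E ..
  have : IsLocalization (Algebra.algebraMapSubmonoid E (nonZeroDivisors B)) (FractionRing E) :=
    IsIntegralClosure.isLocalization _ (FractionRing B) _ _
  have : FiniteDimensional (FractionRing B) (FractionRing E) :=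
    .of_isLocalization B E (nonZeroDivisors B)
  refine ⟨Algebra.intNorm B E g, Algebra.intNorm_ne_zero.mpr hg,
    Algebra.dvd_algebraMap_intNorm_self _ _ g, fun c hc ↦
      ⟨Module.finrank (FractionRing B) (FractionRing E), ?_⟩⟩
  have h : Algebra.intNorm B E (algebraMap B E c) =
      c ^ Module.finrank (FractionRing B) (FractionRing E) := by
    apply IsFractionRing.injective B (FractionRing B)
    rw [Algebra.algebraMap_intNorm_fractionRing, ← IsScalarTower.algebraMap_apply,
      IsScalarTower.algebraMap_apply B (FractionRing B) (FractionRing E), Algebra.norm_algebraMap,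
      map_pow]
  rw [← h]
  exact map_dvd _ hc

theorem RingHom.surjective_of_forall_prime_exists_notMem {A B E : Type*} [CommRing A] [IsDomain A]
    [CommRing B] [IsDomain B] [IsIntegrallyClosed B] [CommRing E] [IsDomain E]
    [UniqueFactorizationMonoid E] [Algebra B E]
    [Module.Finite B E] [Module.IsTorsionFree B E] (φ : B →+* A) (hφ : Function.Injective φ)
    (hloc : ∀ (Q : Ideal A) [Q.IsPrime] (a : A), ∃ b c : B, φ c ∉ Q ∧ φ c * a = φ b)
    (hunit : ∀ h : B, h ≠ 0 → IsUnit (φ h) → IsUnit h) : Function.Surjective φ := by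
  intro a
  have hι : Function.Injective (algebraMap B E) := FaithfulSMul.algebraMap_injective B E
  obtain ⟨b₀, d₀, hd₀, e₀⟩ := hloc ⊥ a
  have hd : d₀ ≠ 0 := by
    rintro rfl
    simp at hd₀
  have hd' : algebraMap B E d₀ ≠ 0 := by simpa using hd
  obtain ⟨x, y, z, hxy, hx, hy⟩ := UniqueFactorizationMonoid.exists_reduced_factors'
    (algebraMap B E b₀) (algebraMap B E d₀) hd'
  have hz : z ≠ 0 := by
    rintro rfl
    simp [← hy] at hd'
  have hy0 : y ≠ 0 := by
    rintro rfl
    simp [← hy] at hd'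
  have hyu : IsUnit y := by
    by_contra hyu
    obtain ⟨g, hgi, hgy⟩ := WfDvdMonoid.exists_irreducible_factor hyu hy0
    have hgp : Prime g := hgi.prime
    have key : ∀ b c : B, φ c * a = φ b → g ∣ algebraMap B E c := by
      intro b c e
      have h1 : c * b₀ = d₀ * b := by
        apply hφ
        rw [map_mul, map_mul, ← e₀, ← e]
        ring
      have h2 : algebraMap B E c * x = y * algebraMap B E b := by
        apply mul_left_cancel₀ hz
        have := congr_arg (algebraMap B E) h1
        rw [map_mul, map_mul, ← hx, ← hy] at this
        linear_combination this
      have h3 : g ∣ algebraMap B E c * x := h2 ▸ hgy.mul_right _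
      exact (hgp.dvd_or_dvd h3).resolve_right fun h ↦ hgi.not_isUnit (hxy h hgy)
    obtain ⟨h, h0, hgh, hpow⟩ := exists_dvd_algebraMap_and_dvd_pow (B := B) hgi.ne_zero
    have hu : IsUnit (φ h) := by
      by_contra hu
      obtain ⟨Q, hQ, hhQ⟩ := exists_max_ideal_of_mem_nonunits hu
      obtain ⟨b, c, hc, e⟩ := hloc Q a
      obtain ⟨n, hn⟩ := hpow c (key b c e)
      have : φ c ^ n ∈ Q := by
        rw [← map_pow]
        exact Q.mem_of_dvd (map_dvd φ hn) hhQ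
      exact hc (hQ.isPrime.mem_of_pow_mem _ this)
    exact hgi.not_isUnit (isUnit_of_dvd_unit hgh ((hunit h h0 hu).map _))
  have hdvd : algebraMap B E d₀ ∣ algebraMap B E b₀ := by
    rw [← hx, ← hy]
    exact mul_dvd_mul_left _ hyu.dvd
  obtain ⟨w, hw⟩ := hdvd
  have hwB : ∃ v : B, algebraMap B E v = w := by
    have hdF : algebraMap B (FractionRing B) d₀ ≠ 0 := by simpa using hd
    let : Algebra (FractionRing B) (FractionRing E) := FractionRing.liftAlgebra _ _
    have : IsScalarTower B (FractionRing B) (FractionRing E) :=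
      FractionRing.isScalarTower_liftAlgebra _ _
    have hwi : _root_.IsIntegral B (algebraMap E (FractionRing E) w) :=
      (Algebra.IsIntegral.isIntegral (R := B) w).algebraMap
    have he : algebraMap E (FractionRing E) w = algebraMap (FractionRing B) (FractionRing E)
        (algebraMap B _ b₀ / algebraMap B _ d₀) := by
      rw [map_div₀, eq_div_iff (by simpa using hd), ← IsScalarTower.algebraMap_apply,
        ← IsScalarTower.algebraMap_apply, IsScalarTower.algebraMap_apply B E (FractionRing E) d₀,
        IsScalarTower.algebraMap_apply B E (FractionRing E) b₀, hw, map_mul, mul_comm]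
    rw [he, isIntegral_algebraMap_iff (FaithfulSMul.algebraMap_injective _ _)] at hwi
    obtain ⟨v, hv⟩ := IsIntegrallyClosed.isIntegral_iff.mp hwi
    refine ⟨v, IsFractionRing.injective E (FractionRing E) ?_⟩
    rw [he, ← hv, ← IsScalarTower.algebraMap_apply, ← IsScalarTower.algebraMap_apply]
  obtain ⟨v, rfl⟩ := hwB
  refine ⟨v, ?_⟩
  rw [← map_mul] at hw
  rw [hι hw, map_mul] at e₀
  exact (mul_left_cancel₀ (by simpa using (map_ne_zero_iff φ hφ).mpr hd) e₀).symm

theorem IsIntegrallyClosed.of_polynomial_forall_prime_exists_notMem {R A : Type*} [CommRing R]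
    [IsDomain R] [CommRing A] [IsDomain A] [IsIntegrallyClosed A]
    (φ : Polynomial R →+* A) (hφ : Function.Injective φ)
    (hloc : ∀ (Q : Ideal A) [Q.IsPrime] (a : A),
      ∃ b c : Polynomial R, φ c ∉ Q ∧ φ c * a = φ b)
    (hmax : ∀ p : Ideal R, p.IsMaximal → p.map (φ.comp Polynomial.C) ≠ ⊤) :
    IsIntegrallyClosed R := by
  have hinj : Function.Injective (φ.comp Polynomial.C) := hφ.comp Polynomial.C_injective
  refine (isIntegrallyClosed_iff (FractionRing R)).mpr fun {x} hx ↦ ?_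
  obtain ⟨c, d, hd, rfl⟩ := IsFractionRing.div_surjective (A := R) x
  have hd0 : d ≠ 0 := nonZeroDivisors.ne_zero hd
  have hd' : algebraMap R (FractionRing R) d ≠ 0 := by simpa using hd0
  let ψ : FractionRing R →+* FractionRing A := IsFractionRing.map hinj
  have hψ (r : R) : ψ (algebraMap R _ r) = algebraMap A _ (φ (Polynomial.C r)) := by
    simp [ψ, IsFractionRing.map]
  -- the fraction `c / d` lies in `A`
  obtain ⟨a, ha⟩ : ∃ a : A, φ (Polynomial.C d) * a = φ (Polynomial.C c) := by
    obtain ⟨P, hP, hP0⟩ := hx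
    have : _root_.IsIntegral A (ψ (algebraMap R _ c / algebraMap R _ d)) := by
      refine ⟨P.map (φ.comp Polynomial.C), hP.map _, ?_⟩
      have := congr_arg ψ hP0
      rw [Polynomial.hom_eval₂, map_zero] at this
      rw [Polynomial.eval₂_map, ← this]
      congr 1
      ext r
      simp [hψ]
    obtain ⟨a, ha⟩ := IsIntegrallyClosed.isIntegral_iff.mp this
    refine ⟨a, IsFractionRing.injective A (FractionRing A) ?_⟩
    rw [map_mul, ha, map_div₀, hψ, hψ, mul_div_cancel₀]
    rw [← hψ]
    exact (map_ne_zero ψ).mpr hd'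
  let I : Ideal R := Submodule.comap (LinearMap.mulRight R c) (Ideal.span {d})
  have hI : I = ⊤ := by
    by_contra hI
    obtain ⟨p, hp, hIp⟩ := Ideal.exists_le_maximal I hI
    obtain ⟨Q, hQ, hpQ⟩ := Ideal.exists_le_maximal _ (hmax p hp)
    obtain ⟨b, e, he, hbe⟩ := hloc Q a
    refine he ?_
    have h1 : e * Polynomial.C c = Polynomial.C d * b := by
      apply hφ
      rw [map_mul, map_mul, ← ha, ← hbe]
      ring
    have h2 (i : ℕ) : e.coeff i ∈ p := by
      apply hIp
      change e.coeff i * c ∈ Ideal.span {d}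
      rw [Ideal.mem_span_singleton]
      refine ⟨b.coeff i, ?_⟩
      rw [← Polynomial.coeff_mul_C, h1, Polynomial.coeff_C_mul]
    have h3 : e ∈ p.map (Polynomial.C : R →+* Polynomial R) := Ideal.mem_map_C_iff.mpr h2
    apply hpQ
    rw [← Ideal.map_map]
    exact Ideal.mem_map_of_mem φ h3
  have h1 : (1 : R) ∈ I := hI ▸ Submodule.mem_top
  have h2 : (1 : R) * c ∈ Ideal.span {d} := h1
  obtain ⟨r, hr⟩ := Ideal.mem_span_singleton.mp h2
  refine ⟨r, ?_⟩
  rw [one_mul] at hr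
  rw [hr, map_mul, mul_div_cancel_left₀ _ hd']

attribute [local instance] Polynomial.algebra in
theorem Polynomial.finite_polynomial (R S : Type*) [CommRing R] [CommRing S] [Algebra R S]
    [Module.Finite R S] : Module.Finite (Polynomial R) (Polynomial S) :=
  Module.Finite.equiv
    (Algebra.IsPushout.equiv R (Polynomial R) S (Polynomial S)).toLinearEquiv

theorem AlgebraicGeometry.IsOpenImmersion.bijective_localRingHom {R S : CommRingCat}
    (φ : R ⟶ S) [h : IsOpenImmersion (Spec.map φ)] (Q : Ideal S) [Q.IsPrime] :
    Function.Bijective (Localization.localRingHom (Q.comap φ.hom) Q φ.hom rfl) := by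
  let q : PrimeSpectrum S := ⟨Q, inferInstance⟩
  have h1 : IsIso ((Spec.map φ).stalkMap q) := (iff_isIso_stalkMap.mp h).2 q
  have h2 : IsIso (CommRingCat.ofHom <| Localization.localRingHom
      (q.comap φ.hom).asIdeal q.asIdeal φ.hom rfl) :=
    ((MorphismProperty.isomorphisms _).arrow_mk_iso_iff
      (Scheme.arrowStalkMapSpecIso φ q)).mp h1
  exact ConcreteCategory.bijective_of_isIso (CommRingCat.ofHom <| Localization.localRingHom
      (q.comap φ.hom).asIdeal q.asIdeal φ.hom rfl)

theorem AlgebraicGeometry.IsOpenImmersion.exists_notMem_and_mul_eq {R S : CommRingCat}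
    (φ : R ⟶ S) [IsOpenImmersion (Spec.map φ)] [IsDomain S] (Q : Ideal S) [Q.IsPrime] (a : S) :
    ∃ b c : R, φ.hom c ∉ Q ∧ φ.hom c * a = φ.hom b := by
  obtain ⟨y, hy⟩ := (bijective_localRingHom φ Q).2 (algebraMap S (Localization.AtPrime Q) a)
  obtain ⟨⟨b, c⟩, hbc⟩ := IsLocalization.surj (Q.comap φ.hom).primeCompl y
  refine ⟨b, c, c.2, ?_⟩
  have hinj : Function.Injective (algebraMap S (Localization.AtPrime Q)) :=
    IsLocalization.injective _ Q.primeCompl_le_nonZeroDivisors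
  apply hinj
  have h := congr_arg (Localization.localRingHom (Q.comap φ.hom) Q φ.hom rfl) hbc
  rw [map_mul, hy, Localization.localRingHom_to_map, Localization.localRingHom_to_map] at h
  rw [map_mul, ← h, mul_comm]

theorem AlgebraicGeometry.IsOpenImmersion.injective_of_isDomain {R S : CommRingCat}
    (φ : R ⟶ S) [IsOpenImmersion (Spec.map φ)] [IsDomain R] [IsDomain S] :
    Function.Injective φ.hom := by
  let Q : Ideal S := ⊥
  have hQ : Q.IsPrime := Ideal.isPrime_bot
  have h : Function.Injective (algebraMap R (Localization.AtPrime (Q.comap φ.hom))) :=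
    IsLocalization.injective _ (Q.comap φ.hom).primeCompl_le_nonZeroDivisors
  refine Function.Injective.of_comp (f := algebraMap S (Localization.AtPrime Q)) ?_
  convert! (bijective_localRingHom φ Q).1.comp h using 1
  ext x
  exact (Localization.localRingHom_to_map _ _ φ.hom rfl x).symm

theorem AlgebraicGeometry.IsOpenImmersion.finiteType_hom {R S : CommRingCat}
    (φ : R ⟶ S) [IsOpenImmersion (Spec.map φ)] : φ.hom.FiniteType :=
  (HasRingHomProperty.Spec_iff (P := @LocallyOfFiniteType)).mp inferInstance

theorem MvPolynomial.exists_aeval_ne_C {k : Type*} [Field k] [Infinite k] {σ : Type*}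
    (c : MvPolynomial σ k) (hc : ∀ y, c ≠ C y) :
    ∃ ψ : MvPolynomial σ k →ₐ[k] Polynomial k, ∀ y, ψ c ≠ Polynomial.C y := by
  obtain ⟨a, ha⟩ : ∃ a : σ → k, eval a c ≠ eval a (C (eval 0 c)) := by
    by_contra! h
    exact hc _ (MvPolynomial.funext h)
  refine ⟨aeval fun i ↦ Polynomial.C (a i) * Polynomial.X, fun y hy ↦ ha ?_⟩
  have h (t : k) : eval (fun i ↦ a i * t) c = y := by
    have := congr_arg (Polynomial.aeval t) hy
    rw [← MvPolynomial.coe_aeval_eq_eval]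
    change MvPolynomial.aeval (fun i ↦ a i * t) c = y
    have e : MvPolynomial.aeval (fun i ↦ a i * t) = (Polynomial.aeval t).comp
        (MvPolynomial.aeval (R := k) fun i ↦ Polynomial.C (a i) * Polynomial.X) := by
      ext i
      simp
    rw [e]
    simpa using this
  have h0 := h 0
  have h1 := h 1
  simp only [mul_zero, mul_one] at h0 h1
  rw [eval_C, h1, ← h0]
  rfl

theorem Polynomial.isIntegral_of_ne_C {R k : Type*} [CommRing R] [Field k]
    [Algebra R (Polynomial k)] (hk : ∀ y : k, IsIntegral R (C y))
    (r : R) (hr : ∀ y : k, algebraMap R (Polynomial k) r ≠ C y) :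
    Algebra.IsIntegral R (Polynomial k) := by
  set p := algebraMap R (Polynomial k) r with hp
  have hdeg : 0 < p.natDegree := by
    by_contra h
    exact hr _ (eq_C_of_natDegree_eq_zero (by omega))
  have hp0 : p ≠ 0 := by rintro h; simp [h] at hdeg
  -- `X` is a root of the monic polynomial obtained from `p(Y) - p(X)` by scaling
  let I := integralClosure R (Polynomial k)
  let i : k →+* I := (C : k →+* Polynomial k).codRestrict I hk
  let P : Polynomial I := p.map i - C (algebraMap R I r)
  have hX : IsIntegral I (X : Polynomial k) := by
    have hlc : i (p.leadingCoeff)⁻¹ * i p.leadingCoeff = 1 := by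
      rw [← map_mul, inv_mul_cancel₀ (by simpa using hp0), map_one]
    refine ⟨C (i (p.leadingCoeff)⁻¹) * P, ?_, ?_⟩
    · refine monic_C_mul_of_mul_leadingCoeff_eq_one ?_
      have hd : (p.map i).natDegree = p.natDegree := natDegree_map _
      rw [leadingCoeff, leadingCoeff, natDegree_sub_C, hd, coeff_sub, coeff_map, coeff_C_of_ne_zero hdeg.ne',
        sub_zero]
      exact hlc
    · have : (p.map i).eval₂ (algebraMap I (Polynomial k)) X = p := by
        rw [eval₂_map]
        exact eval₂_C_X
      rw [eval₂_mul, eval₂_C, eval₂_sub, this, eval₂_C, ← IsScalarTower.algebraMap_apply, ← hp, sub_self,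
        mul_zero]
  have hX' : IsIntegral R (X : Polynomial k) := isIntegral_trans X hX
  refine ⟨fun q ↦ ?_⟩
  induction q using Polynomial.induction_on with
  | C a => exact hk a
  | add f g hf hg => exact hf.add hg
  | monomial n a _ => exact (hk a).mul (hX'.pow _)

/-- A unit of `k[σ]` is constant, so a field mapping to `k[σ]` lands in the constants. -/
theorem MvPolynomial.ringHom_eq_C_constantCoeff {K k σ : Type*} [Field K] [Field k]
    (j : K →+* MvPolynomial σ k) (x : K) : j x = C (constantCoeff (j x)) := by
  rcases eq_or_ne x 0 with rfl | hx
  · simp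
  · obtain ⟨r, -, hr⟩ := isUnit_iff_eq_C_of_isReduced.mp ((IsUnit.mk0 x hx).map j)
    simp [hr]

attribute [local instance] Polynomial.algebra in
theorem Polynomial.surjective_of_forall_prime_exists_notMem {κ C₀ : Type*} [Field κ] [Infinite κ]
    [CommRing C₀] [IsDomain C₀] [Algebra κ C₀] [Algebra.FiniteType κ C₀]
    (hdim : ringKrullDim C₀ = 1) {σ : Type*} (φ : Polynomial C₀ →+* MvPolynomial σ κ)
    (hφ : Function.Injective φ) (hft : φ.FiniteType)
    (hloc : ∀ (Q : Ideal (MvPolynomial σ κ)) [Q.IsPrime] (a : MvPolynomial σ κ),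
      ∃ b c : Polynomial C₀, φ c ∉ Q ∧ φ c * a = φ b) : Function.Surjective φ := by
  let j : κ →+* MvPolynomial σ κ := φ.comp (algebraMap κ (Polynomial C₀))
  have hj : j.FiniteType := hft.comp (RingHom.finiteType_algebraMap.mpr inferInstance)
  let j₀ : κ →+* κ := MvPolynomial.constantCoeff.comp j
  have hjC (x : κ) : j x = MvPolynomial.C (j₀ x) := MvPolynomial.ringHom_eq_C_constantCoeff j x
  have hj₀ : j₀.FiniteType :=
    (RingHom.FiniteType.of_surjective _ (fun y ↦ ⟨MvPolynomial.C y, by simp⟩)).comp hj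
  have hj₀int : j₀.IsIntegral :=
    (RingHom.finite_iff_finiteType_of_isJacobsonRing.mpr hj₀).to_isIntegral
  have hconst (b : Polynomial C₀) (y : κ) (hb : φ b = MvPolynomial.C y) :
      _root_.IsIntegral κ b := by
    obtain ⟨P, hP, hP0⟩ := hj₀int y
    refine ⟨P, hP, hφ ?_⟩
    have hjC' : j = MvPolynomial.C.comp j₀ := RingHom.ext hjC
    rw [Polynomial.hom_eval₂, map_zero, hb]
    change P.eval₂ j _ = 0
    rw [hjC', ← Polynomial.hom_eval₂, hP0, map_zero]
  have hunit (h : Polynomial C₀) (h0 : h ≠ 0) (hu : IsUnit (φ h)) : IsUnit h := by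
    obtain ⟨r, -, hr⟩ := MvPolynomial.isUnit_iff_eq_C_of_isReduced.mp hu
    exact (hconst h r hr).isUnit h0
  obtain ⟨c, hc⟩ : ∃ c : C₀, ∀ y, φ (Polynomial.C c) ≠ MvPolynomial.C y := by
    by_contra! h
    have : Algebra.IsIntegral κ C₀ := by
      refine ⟨fun c ↦ ?_⟩
      obtain ⟨y, hy⟩ := h c
      exact (isIntegral_algebraMap_iff (B := Polynomial C₀) Polynomial.C_injective).mp
        (hconst _ y hy)
    have hF : IsField C₀ := isField_of_isIntegral_of_isField' (Field.toIsField κ)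
    rw [ringKrullDim_eq_zero_of_isField hF] at hdim
    exact zero_ne_one hdim
  obtain ⟨ψ, hψ⟩ := MvPolynomial.exists_aeval_ne_C _ hc
  let χ : C₀ →+* Polynomial κ := (ψ : MvPolynomial σ κ →+* Polynomial κ).comp (φ.comp Polynomial.C)
  let : Algebra C₀ (Polynomial κ) := χ.toAlgebra
  have hχ : χ.comp (algebraMap κ C₀) = Polynomial.C.comp j₀ := by
    ext1 x
    change ψ (j x) = Polynomial.C (j₀ x)
    rw [hjC]
    exact ψ.commutes _
  have hk (y : κ) : _root_.IsIntegral C₀ (Polynomial.C y) := by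
    obtain ⟨P, hP, hP0⟩ := hj₀int y
    refine ⟨P.map (algebraMap κ C₀), hP.map _, ?_⟩
    rw [Polynomial.eval₂_map]
    change P.eval₂ (χ.comp (algebraMap κ C₀)) _ = 0
    rw [hχ, ← Polynomial.hom_eval₂, hP0, map_zero]
  have hCint : Algebra.IsIntegral C₀ (Polynomial κ) := Polynomial.isIntegral_of_ne_C hk c hψ
  have hft' : χ.FiniteType := by
    refine RingHom.FiniteType.of_comp_finiteType (f := algebraMap κ C₀) ?_
    rw [hχ]
    exact (RingHom.finiteType_algebraMap.mpr
      (inferInstanceAs (Algebra.FiniteType κ (Polynomial κ)))).comp hj₀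
  have : Algebra.FiniteType C₀ (Polynomial κ) := hft'
  have : Module.Finite C₀ (Polynomial κ) := Algebra.IsIntegral.finite
  have hχinj : Function.Injective χ := by
    have : Ring.KrullDimLE 1 C₀ := Ring.krullDimLE_iff.mpr hdim.le
    rw [RingHom.injective_iff_ker_eq_bot]
    by_contra hker
    have hmax : (RingHom.ker χ).IsMaximal :=
      (RingHom.ker_isPrime χ).isMaximal_of_ne_bot hker
    have hbot : (⊥ : Ideal (Polynomial κ)).IsMaximal :=
      Ideal.isMaximal_of_isIntegral_of_isMaximal_comap (R := C₀) ⊥ hmax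
    exact Polynomial.not_isField κ (Ring.isField_iff_maximal_bot.mpr hbot)
  have : FaithfulSMul C₀ (Polynomial κ) := (faithfulSMul_iff_algebraMap_injective _ _).mpr hχinj
  have hC₀ : IsIntegrallyClosed C₀ := by
    refine .of_polynomial_forall_prime_exists_notMem φ hφ hloc fun p hp htop ↦ hp.ne_top ?_
    refine (Ideal.map_eq_top_iff χ hχinj (algebraMap_isIntegral_iff.mpr hCint)).mp ?_
    rw [← Ideal.map_map, htop, Ideal.map_top]
  have : Module.Finite (Polynomial C₀) (Polynomial (Polynomial κ)) :=
    Polynomial.finite_polynomial _ _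
  exact φ.surjective_of_forall_prime_exists_notMem (E := Polynomial (Polynomial κ)) hφ hloc hunit

theorem statement15 {κ : Type} [Field κ] [CharZero κ]
    (C₀ : Type) [CommRing C₀] [IsDomain C₀] [Algebra κ C₀]
    -- C₀ is a finitely generated κ-algebra of Krull dimension 1
    (hfg : Algebra.FiniteType κ C₀) (hdim : ringKrullDim C₀ = 1)
    -- an open immersion Spec κ[u,v] → Spec C₀[T]
    (f : Spec (CommRingCat.of (MvPolynomial (Fin 2) κ)) ⟶
      Spec (CommRingCat.of (Polynomial C₀)))
    [IsOpenImmersion f] :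
    IsIso f := by
  obtain ⟨φ, rfl⟩ := Spec.map_surjective f
  have hφ : Function.Injective φ.hom := IsOpenImmersion.injective_of_isDomain φ
  have hsurj : Function.Surjective φ.hom :=
    Polynomial.surjective_of_forall_prime_exists_notMem hdim φ.hom hφ
      (IsOpenImmersion.finiteType_hom φ) (IsOpenImmersion.exists_notMem_and_mul_eq φ)
  have : IsIso φ := (ConcreteCategory.isIso_iff_bijective φ).mpr ⟨hφ, hsurj⟩
  infer_instance
end

section
/- Let κ be a field of characteristic 0. Then every open immersion of schemes from Spec κ[u,v] to Spec κ[u,v] (i.e., every open immersion from the affine plane A²_κ to itself) is an isomorphism; in particular it is surjective. -/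
/- STATEMENT 16: Every open immersion from the affine plane A²_κ to itself is
an isomorphism; in particular it is surjective. -/

open AlgebraicGeometry CategoryTheory

/-- Over a basic open contained in its image, an open immersion of affine schemes induces an
isomorphism of localizations. -/
theorem awayMap_bijective_of_basicOpen_le_opensRange {R S : CommRingCat} (φ : R ⟶ S)
    [IsOpenImmersion (Spec.map φ)] {h : R}
    (hh : PrimeSpectrum.basicOpen h ≤ (Spec.map φ).opensRange) :
    Function.Bijective (Localization.awayMap φ.hom h) := by
  have : IsIso ((Spec.map φ).app (PrimeSpectrum.basicOpen h)) := (Spec.map φ).isIso_app _ hh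
  have : IsIso (Spec.map φ ∣_ PrimeSpectrum.basicOpen h) :=
    (isIso_morphismRestrict_iff_isIso_app _ (IsAffineOpen.Spec_basicOpen h)).mpr this
  have : IsIso (Scheme.Spec.map (CommRingCat.ofHom (Localization.awayMap φ.hom h)).op) :=
    ((MorphismProperty.isomorphisms Scheme).arrow_mk_iso_iff
      (SpecMapRestrictBasicOpenIso φ h)).mp this
  have : IsIso (CommRingCat.ofHom (Localization.awayMap φ.hom h)) :=
    (isIso_op_iff _).mp (isIso_of_reflects_iso _ Scheme.Spec)
  exact ConcreteCategory.bijective_of_isIso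
    (CommRingCat.ofHom (Localization.awayMap φ.hom h))

theorem exists_map_eq_pow_mul_of_basicOpen_le_opensRange {R S : CommRingCat} [IsDomain S]
    (φ : R ⟶ S) [IsOpenImmersion (Spec.map φ)] {h : R}
    (hh : PrimeSpectrum.basicOpen h ≤ (Spec.map φ).opensRange) (h0 : φ h ≠ 0) (a : S) :
    ∃ (n : ℕ) (r : R), φ r = φ h ^ n * a := by
  obtain ⟨s, hs⟩ := (awayMap_bijective_of_basicOpen_le_opensRange φ hh).surjective
    (algebraMap S (Localization.Away (φ.hom h)) a)
  obtain ⟨r, ⟨_, n, rfl⟩, rfl⟩ := IsLocalization.exists_mk'_eq (Submonoid.powers h) s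
  refine ⟨n, r, ?_⟩
  apply IsLocalization.injective (Localization.Away (φ.hom h)) (M := .powers (φ.hom h))
    (powers_le_nonZeroDivisors_of_noZeroDivisors h0)
  rw [Localization.awayMap, IsLocalization.Away.map, IsLocalization.map_mk',
    IsLocalization.mk'_eq_iff_eq_mul] at hs
  simpa [mul_comm] using hs

theorem injective_of_isOpenImmersion_SpecMap {R S : CommRingCat} [IsDomain R] [Nontrivial S]
    (φ : R ⟶ S) [IsOpenImmersion (Spec.map φ)] : Function.Injective φ := by
  have hd : DenseRange (PrimeSpectrum.comap φ.hom) :=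
    (Spec.map φ).isOpenEmbedding.isOpen_range.dense (Set.range_nonempty (Spec.map φ))
  rw [PrimeSpectrum.denseRange_comap_iff_ker_le_nilRadical, nilradical_eq_zero] at hd
  exact (RingHom.injective_iff_ker_eq_bot φ.hom).mpr (le_bot_iff.mp hd)

theorem exists_basicOpen_le_opensRange_SpecMap {R S : CommRingCat} (φ : R ⟶ S)
    [IsOpenImmersion (Spec.map φ)] (x : PrimeSpectrum S) :
    ∃ h : R, PrimeSpectrum.basicOpen h ≤ (Spec.map φ).opensRange ∧ φ h ∉ x.asIdeal := by
  obtain ⟨_, ⟨h, rfl⟩, hx, hle⟩ :=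
    PrimeSpectrum.isTopologicalBasis_basic_opens.exists_subset_of_mem_open
      (a := PrimeSpectrum.comap φ.hom x) (u := Set.range (Spec.map φ)) (Set.mem_range_self x)
      (Spec.map φ).isOpenEmbedding.isOpen_range
  exact ⟨h, hle, hx⟩

theorem dvd_of_isUnit_map_of_basicOpen_le_opensRange {R S : CommRingCat} (φ : R ⟶ S)
    [IsOpenImmersion (Spec.map φ)] {h : R}
    (hh : PrimeSpectrum.basicOpen h ≤ (Spec.map φ).opensRange) {q : R} (hq : Prime q)
    (hu : IsUnit (φ q)) : q ∣ h := by
  by_contra hqh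
  let x : PrimeSpectrum R := ⟨Ideal.span {q}, (Ideal.span_singleton_prime hq.ne_zero).mpr hq⟩
  have hx : x ∈ PrimeSpectrum.basicOpen h := fun H ↦ hqh (Ideal.mem_span_singleton.mp H)
  obtain ⟨y, hy⟩ := hh hx
  have hqx : q ∈ x.asIdeal := Ideal.mem_span_singleton_self q
  rw [← hy] at hqx
  exact y.isPrime.ne_top (Ideal.eq_top_of_isUnit_mem _ hqx hu)

/-- An open immersion from `Spec S` into the spectrum of a factorial domain `R` is an isomorphism
if no prime element of `R` becomes a unit in `S`. -/
theorem isIso_SpecMap_of_not_isUnit_map_prime {R S : CommRingCat} [IsDomain R]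
    [UniqueFactorizationMonoid R] [IsDomain S] (φ : R ⟶ S) [IsOpenImmersion (Spec.map φ)]
    (hφ : ∀ p : R, Prime p → ¬ IsUnit (φ p)) : IsIso (Spec.map φ) := by
  have hinj := injective_of_isOpenImmersion_SpecMap φ
  have h_ne {r : R} (hr : r ≠ 0) : φ r ≠ 0 := (map_ne_zero_iff _ hinj).mpr hr
  have hsurj : Function.Surjective φ := by
    intro a
    obtain ⟨h, hh, h0⟩ := exists_basicOpen_le_opensRange_SpecMap φ ⊥
    replace h0 : φ h ≠ 0 := h0
    obtain ⟨n, r, hr⟩ := exists_map_eq_pow_mul_of_basicOpen_le_opensRange φ hh h0 a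
    have hn0 : h ^ n ≠ 0 := pow_ne_zero n fun H ↦ h0 (by rw [H, map_zero])
    obtain ⟨b, s, c, hbs, hcb, rfl⟩ := UniqueFactorizationMonoid.exists_reduced_factors _ hn0 r
    rw [← map_pow, ← hcb, map_mul, map_mul, mul_assoc] at hr
    rw [← hcb] at hn0
    replace hr := mul_left_cancel₀ (h_ne (left_ne_zero_of_mul hn0)) hr
    have hb : IsUnit b := by
      by_contra hb
      obtain ⟨p, hp, hpb⟩ := WfDvdMonoid.exists_irreducible_factor hb (right_ne_zero_of_mul hn0)
      obtain ⟨m, hm, hpm⟩ := exists_max_ideal_of_mem_nonunits (hφ p hp.prime)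
      obtain ⟨h', hh', hm'⟩ := exists_basicOpen_le_opensRange_SpecMap φ ⟨m, hm.isPrime⟩
      have hph' : ¬ p ∣ h' := by
        rintro ⟨d, rfl⟩
        exact hm' (by rw [map_mul]; exact m.mul_mem_right _ hpm)
      obtain ⟨k, r', hr'⟩ := exists_map_eq_pow_mul_of_basicOpen_le_opensRange φ hh'
        (h_ne fun H ↦ hph' (H ▸ dvd_zero p)) a
      have heq : b * r' = h' ^ k * s := hinj (by
        rw [map_mul, map_mul, map_pow, hr, hr']; ring)
      rcases hp.prime.dvd_or_dvd (heq ▸ hpb.mul_right r') with H | H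
      · exact hph' (hp.prime.dvd_of_dvd_pow H)
      · exact hp.not_isUnit (hbs hpb H)
    obtain ⟨b', hb'⟩ := hb.exists_left_inv
    exact ⟨b' * s, by rw [map_mul, hr, ← mul_assoc, ← map_mul, hb', map_one, one_mul]⟩
  have : IsIso φ := (ConcreteCategory.isIso_iff_bijective φ).mpr ⟨hinj, hsurj⟩
  infer_instance

/-- An injective endomorphism of a polynomial ring over a field sends no prime element to a unit
as soon as it does so for only finitely many of them up to associates. -/
theorem MvPolynomial.not_isUnit_map_prime {κ σ : Type*} [Field κ]
    {φ : MvPolynomial σ κ →+* MvPolynomial σ κ} (hφ : Function.Injective φ)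
    {h : MvPolynomial σ κ} (h0 : h ≠ 0)
    (hh : ∀ q, Prime q → IsUnit (φ q) → q ∣ h) {p : MvPolynomial σ κ} (hp : Prime p) :
    ¬ IsUnit (φ p) := by
  classical
  intro hpu
  let g := ((UniqueFactorizationMonoid.factors h).filter fun q ↦ IsUnit (φ q)).prod
  have hg : IsUnit (φ g) := by
    refine Multiset.prod_induction (fun x ↦ IsUnit (φ x)) _ ?_ (by simp) fun q hq ↦
      (Multiset.mem_filter.mp hq).2
    intro x y hx hy
    rw [map_mul]
    exact hx.mul hy
  have hdvd (q : MvPolynomial σ κ) (hq : Prime q) (hqu : IsUnit (φ q)) : q ∣ g := by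
    obtain ⟨q', hq', hqq'⟩ := UniqueFactorizationMonoid.exists_mem_factors_of_dvd h0
      hq.irreducible (hh q hq hqu)
    exact hqq'.dvd.trans (Multiset.dvd_prod
      (Multiset.mem_filter.mpr ⟨hq', (hqq'.map φ).isUnit hqu⟩))
  have hg0 : g ≠ 0 := fun H ↦ by simp [H] at hg
  have hgu : ¬ IsUnit g := fun H ↦ hp.not_isUnit (isUnit_of_dvd_unit (hdvd p hp hpu) H)
  have hg1 : g - 1 ≠ 0 := fun H ↦ hgu (by simp [sub_eq_zero.mp H])
  have hgu1 : ¬ IsUnit (g - 1) := by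
    intro H
    obtain ⟨d, -, hd⟩ := MvPolynomial.isUnit_iff_eq_C_of_isReduced.mp H
    have hgC : g = MvPolynomial.C (d + 1) := by rw [map_add, ← hd]; simp
    refine hgu (hgC ▸ (IsUnit.mk0 (d + 1) fun H ↦ hg0 ?_).map MvPolynomial.C)
    rw [hgC, H, map_zero]
  obtain ⟨q, hq, hqg⟩ := WfDvdMonoid.exists_irreducible_factor hgu1 hg1
  have hu : IsUnit (φ (g - 1)) := by
    obtain ⟨c, -, hc⟩ := MvPolynomial.isUnit_iff_eq_C_of_isReduced.mp hg
    have hc1 : φ (g - 1) = MvPolynomial.C (c - 1) := by simp [hc]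
    have hne := (map_ne_zero_iff _ hφ).mpr hg1
    rw [hc1] at hne ⊢
    exact (IsUnit.mk0 (c - 1) fun H ↦ hne (by rw [H, map_zero])).map MvPolynomial.C
  have hqg' := hdvd q hq.prime (isUnit_of_dvd_unit (map_dvd φ hqg) hu)
  exact hq.not_isUnit (isUnit_of_dvd_one (by simpa using dvd_sub hqg' hqg))

theorem statement16 {κ : Type} [Field κ] [CharZero κ]
    (f : Spec (CommRingCat.of (MvPolynomial (Fin 2) κ)) ⟶
      Spec (CommRingCat.of (MvPolynomial (Fin 2) κ)))
    [IsOpenImmersion f] :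
    IsIso f ∧ Function.Surjective f.base := by
  obtain ⟨φ, rfl⟩ := Spec.map_surjective f
  have hinj := injective_of_isOpenImmersion_SpecMap φ
  obtain ⟨h, hh, h0⟩ := exists_basicOpen_le_opensRange_SpecMap φ ⊥
  have : IsIso (Spec.map φ) := isIso_SpecMap_of_not_isUnit_map_prime φ fun p hp ↦
    MvPolynomial.not_isUnit_map_prime (φ := φ.hom) hinj
      (fun H ↦ h0 (by rw [H, map_zero]; exact Ideal.zero_mem _))
      (fun q hq hu ↦ dvd_of_isUnit_map_of_basicOpen_le_opensRange φ hh hq hu) hp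
  exact ⟨this, (Spec.map φ).homeomorph.surjective⟩
end
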